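/- arXiv:2603.10972 — 2 statements merged into one kernel-verified Lean document; each statement's English description precedes it below -/
import Mathlib

section
/- Fix an integer N ≥ 6 and complex numbers c₃₀, c₁₀, c₁₁, c₀₁. On R_N := MvPolynomial (ZMod N) ℂ define H := Σ_i ( a†_i∘a_{i+1} + a†_{i+1}∘a_i + c₃₀·(a†_i)³ + c₁₀·a†_i + c₁₁·n_i + c₀₁·a_i ) and Q₃ := Σ_i ( a†_i∘a_{i+2} − a†_{i+2}∘a_i ) − 3c₃₀·Σ_i ( (a†_i)²∘a†_{i+1} − a†_i∘(a†_{i+1})² ) + (3c₁₁ − 2)·Σ_i ( a†_i∘a_{i+1} − a†_{i+1}∘a_i ). Then ⁅Q₃, H⁆ = 0; i.e., the degree-3 non-Hermitian bosonic chain possesses this 3-local conserved charge. -/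
open MvPolynomial

noncomputable section

/-- Creation operator at site `i` of the periodic bosonic chain:
multiplication by the variable `X i` on `MvPolynomial (ZMod N) ℂ`. -/
def ad (N : ℕ) (i : ZMod N) : Module.End ℂ (MvPolynomial (ZMod N) ℂ) :=
  LinearMap.mulLeft ℂ (X i)

/-- Annihilation operator at site `i`: the partial derivative `pderiv i`. -/
def an (N : ℕ) (i : ZMod N) : Module.End ℂ (MvPolynomial (ZMod N) ℂ) :=
  (pderiv i).toLinearMap

/-- The derivation sending each `X j` to `X (j - r)`. -/
def hop (N : ℕ) (r : ZMod N) :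
    Derivation ℂ (MvPolynomial (ZMod N) ℂ) (MvPolynomial (ZMod N) ℂ) :=
  mkDerivation ℂ fun j => X (j - r)

/-- The derivation sending each `X j` to `1`. -/
def totalDeriv (N : ℕ) :
    Derivation ℂ (MvPolynomial (ZMod N) ℂ) (MvPolynomial (ZMod N) ℂ) :=
  mkDerivation ℂ fun _ => 1

@[simp] lemma hop_X (N : ℕ) (r j : ZMod N) : hop N r (X j) = X (j - r) :=
  mkDerivation_X _ _ _

@[simp] lemma totalDeriv_X (N : ℕ) (j : ZMod N) : totalDeriv N (X j) = 1 :=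
  mkDerivation_X _ _ _

lemma sum_ad_mul_an (N : ℕ) [NeZero N] (a b : ZMod N) :
    ∑ i : ZMod N, ad N (i + a) * an N (i + b) = (hop N (b - a)).toLinearMap := by
  have key : (∑ i : ZMod N, (X (i + a) : MvPolynomial (ZMod N) ℂ) •
      (pderiv (i + b) : Derivation ℂ (MvPolynomial (ZMod N) ℂ) (MvPolynomial (ZMod N) ℂ)))
        = hop N (b - a) := by
    refine derivation_ext fun j => ?_
    rw [← Derivation.coeFnAddMonoidHom_apply, map_sum, Finset.sum_apply,
      Finset.sum_eq_single (j - b)]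
    · simp only [Derivation.coeFnAddMonoidHom_apply, Derivation.smul_apply, sub_add_cancel,
        pderiv_X_self, smul_eq_mul, mul_one, hop_X]
      congr 1
      abel
    · intro i _ hi
      have : j ≠ i + b := fun h => hi (by rw [h, add_sub_cancel_right])
      simp [pderiv_X_of_ne this]
    · simp
  rw [← key]
  refine LinearMap.ext fun p => ?_
  rw [LinearMap.sum_apply, Derivation.coeFn_coe,
    ← Derivation.coeFnAddMonoidHom_apply, map_sum, Finset.sum_apply]
  rfl

lemma sum_an (N : ℕ) [NeZero N] :
    ∑ i : ZMod N, an N i = (totalDeriv N).toLinearMap := by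
  have key : (∑ i : ZMod N,
      (pderiv i : Derivation ℂ (MvPolynomial (ZMod N) ℂ) (MvPolynomial (ZMod N) ℂ)))
        = totalDeriv N := by
    refine derivation_ext fun j => ?_
    rw [← Derivation.coeFnAddMonoidHom_apply, map_sum, Finset.sum_apply,
      Finset.sum_eq_single j]
    · simp
    · intro i _ hi
      simp [pderiv_X_of_ne hi.symm]
    · simp
  rw [← key]
  refine LinearMap.ext fun p => ?_
  rw [LinearMap.sum_apply, Derivation.coeFn_coe,
    ← Derivation.coeFnAddMonoidHom_apply, map_sum, Finset.sum_apply]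
  rfl

lemma ad_eq_lmul (N : ℕ) (i : ZMod N) :
    ad N i = Algebra.lmul ℂ (MvPolynomial (ZMod N) ℂ) (X i) := rfl

lemma lie_derivation_add_lmul {R A : Type*} [CommRing R] [CommRing A] [Algebra R A]
    (D E : Derivation R A A) (q h : A) :
    ⁅D.toLinearMap + Algebra.lmul R A q, E.toLinearMap + Algebra.lmul R A h⁆
      = ⁅D, E⁆.toLinearMap + Algebra.lmul R A (D h - E q) := by
  refine LinearMap.ext fun p => ?_
  simp [Ring.lie_def]
  ring

lemma sum_shift_sub {G M : Type*} [AddGroup G] [Fintype G] [AddCommGroup M]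
    (f : G → M) (a : G) : ∑ i, (f (i + a) - f i) = 0 := by
  rw [Finset.sum_sub_distrib, sub_eq_zero]
  exact Equiv.sum_comp (Equiv.addRight a) f

/-- The degree-3 non-Hermitian bosonic chain possesses the displayed
3-local conserved charge `Q₃`. -/
theorem degree3_three_local_charge (N : ℕ) [NeZero N] (hN : 6 ≤ N)
    (c30 c10 c11 c01 : ℂ)
    (H Q3 : Module.End ℂ (MvPolynomial (ZMod N) ℂ))
    (hH : H = ∑ i : ZMod N,
        (ad N i * an N (i + 1) + ad N (i + 1) * an N i
          + c30 • (ad N i) ^ 3 + c10 • ad N i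
          + c11 • (ad N i * an N i) + c01 • an N i))
    (hQ : Q3 = (∑ i : ZMod N, (ad N i * an N (i + 2) - ad N (i + 2) * an N i))
        - (3 * c30) • ∑ i : ZMod N,
            ((ad N i) ^ 2 * ad N (i + 1) - ad N i * (ad N (i + 1)) ^ 2)
        + (3 * c11 - 2) • ∑ i : ZMod N,
            (ad N i * an N (i + 1) - ad N (i + 1) * an N i)) :
    ⁅Q3, H⁆ = 0 := by
  set DH := hop N 1 + hop N (-1) + c11 • hop N 0 + c01 • totalDeriv N with hDH
  set DQ := hop N 2 - hop N (-2) + (3 * c11 - 2) • (hop N 1 - hop N (-1)) with hDQ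
  set h : MvPolynomial (ZMod N) ℂ := ∑ i : ZMod N, (C c30 * X i ^ 3 + C c10 * X i) with hh
  set v : MvPolynomial (ZMod N) ℂ :=
    ∑ i : ZMod N, (X i ^ 2 * X (i + 1) - X i * X (i + 1) ^ 2) with hv
  have hop_pos (r : ZMod N) :
      ∑ i : ZMod N, ad N i * an N (i + r) = (hop N r).toLinearMap := by
    simpa using sum_ad_mul_an N 0 r
  have hop_neg (r : ZMod N) :
      ∑ i : ZMod N, ad N (i + r) * an N i = (hop N (-r)).toLinearMap := by
    simpa using sum_ad_mul_an N r 0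
  have hop_zero : ∑ i : ZMod N, ad N i * an N i = (hop N 0).toLinearMap := by
    simpa using sum_ad_mul_an N 0 0
  have eH : H = DH.toLinearMap + Algebra.lmul ℂ _ h := by
    have e : Algebra.lmul ℂ _ h = ∑ i : ZMod N, (c30 • ad N i ^ 3 + c10 • ad N i) := by
      simp only [hh, map_sum, map_add, ← smul_eq_C_mul, map_smul, map_pow, ad_eq_lmul]
    rw [hH, e]
    simp only [Finset.sum_add_distrib, ← Finset.smul_sum, hop_pos, hop_neg, hop_zero, sum_an]
    refine LinearMap.ext fun p => ?_
    simp [hDH]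
    ring
  have eQ : Q3 = DQ.toLinearMap + Algebra.lmul ℂ _ (-C (3 * c30) * v) := by
    have e : Algebra.lmul ℂ _ (-C (3 * c30) * v) = -((3 * c30) • ∑ i : ZMod N,
        (ad N i ^ 2 * ad N (i + 1) - ad N i * ad N (i + 1) ^ 2)) := by
      rw [neg_mul, ← smul_eq_C_mul, map_neg, map_smul, hv]
      simp only [map_sum, map_sub, map_mul, map_pow, ad_eq_lmul]
    rw [hQ, e]
    simp only [Finset.sum_sub_distrib, hop_pos, hop_neg]
    refine LinearMap.ext fun p => ?_
    simp [hDQ]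
    ring
  have DHX (j : ZMod N) : DH (X j) = X (j - 1) + X (j + 1) + C c11 * X j + C c01 := by
    simp [hDH, smul_eq_C_mul]
  have DQX (j : ZMod N) : DQ (X j) = X (j - 2) - X (j + 2)
      + C (3 * c11 - 2) * (X (j - 1) - X (j + 1)) := by
    simp [hDQ, smul_eq_C_mul]
  have DC (D : Derivation ℂ (MvPolynomial (ZMod N) ℂ) (MvPolynomial (ZMod N) ℂ)) (c : ℂ) :
      D (C c) = 0 := D.map_algebraMap c
  have comm : ⁅DQ, DH⁆ = 0 := by
    refine derivation_ext fun j => ?_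
    simp only [Derivation.commutator_apply, DHX, DQX, map_add, map_sub, Derivation.leibniz, DC,
      smul_eq_mul, Derivation.zero_apply]
    ring_nf
  have pot : DQ h - DH (-C (3 * c30) * v) = 0 := by
    let F (j : ZMod N) : MvPolynomial (ZMod N) ℂ :=
      -C (3 * c30) * (X j ^ 2 * X (j - 2)) - C c10 * (X j + X (j - 2))
    let G (j : ZMod N) : MvPolynomial (ZMod N) ℂ :=
      -C (3 * c30) * (C (3 * c11 - 2) * (X j ^ 2 * X (j - 1))
        + 2 * (X (j - 1) * X j * X (j + 1)) - X (j - 1) * X (j + 1) ^ 2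
        + X j ^ 3 + C c01 * X j ^ 2) - C c10 * C (3 * c11 - 2) * (X j + X (j - 1))
    have summand (i : ZMod N) :
        DQ (C c30 * X i ^ 3 + C c10 * X i)
          + C (3 * c30) * DH (X i ^ 2 * X (i + 1) - X i * X (i + 1) ^ 2) =
        (F (i + 2) - F i) + (G (i + 1) - G i) := by
      have h2 : i + 1 + 1 = i + 2 := by ring
      simp only [F, G, map_add, map_sub, Derivation.leibniz, Derivation.leibniz_pow, DC, DHX, DQX,
        smul_eq_mul, nsmul_eq_mul, add_sub_cancel_right, h2, map_mul]
      have e3 : (C 3 : MvPolynomial (ZMod N) ℂ) = 3 := map_ofNat C 3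
      have e2 : (C 2 : MvPolynomial (ZMod N) ℂ) = 2 := map_ofNat C 2
      rw [e3, e2]
      push_cast
      ring
    have expand : DQ h - DH (-C (3 * c30) * v) = ∑ i : ZMod N,
        (DQ (C c30 * X i ^ 3 + C c10 * X i)
          + C (3 * c30) * DH (X i ^ 2 * X (i + 1) - X i * X (i + 1) ^ 2)) := by
      rw [Finset.sum_add_distrib, ← Finset.mul_sum, ← map_sum, ← map_sum, ← hh, ← hv, neg_mul,
        map_neg, sub_neg_eq_add, Derivation.leibniz, DC, smul_zero, add_zero, smul_eq_mul]
    rw [expand, Finset.sum_congr rfl fun i _ => summand i, Finset.sum_add_distrib,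
      sum_shift_sub, sum_shift_sub, add_zero]
  rw [eH, eQ, lie_derivation_add_lmul, comm, pot, map_zero, add_zero]
  rfl

end
end

section
/- Let N be an even integer with N ≥ 6, let k satisfy 3 ≤ k and 2k ≤ N, and let c₂₀, c₁₀, c₀₁, c₀₂ ∈ ℂ. On R_N := MvPolynomial (ZMod N) ℂ set g_i := c₂₀·(a†_i)² + c₁₀·a†_i + c₀₁·a_i + c₀₂·(a_i)² and H := Σ_i ( a†_i∘a_{i+1} + a†_{i+1}∘a_i + g_i ). Define Q_k^{++} := Σ_i (−1)^i·( a†_i∘a†_{i+k−1} + c₀₂·( a†_i∘a_{i+k−2} − a†_{i+k−2}∘a_i ) + a†_i∘a†_{i+k−3} ) for k even, and Q_k^{++} := Σ_i (−1)^i·( a†_i∘a†_{i+k−1} + c₀₂·( a†_i∘a_{i+k−2} − a†_{i+k−2}∘a_i ) + a†_i∘a†_{i+k−3} − c₀₂·g_i + 2c₀₁·a†_i ) for k odd; define Q_k^{−−} := Σ_i (−1)^i·( a_i∘a_{i+k−1} + c₂₀·( a†_{i+k−2}∘a_i − a†_i∘a_{i+k−2} ) + a_i∘a_{i+k−3} )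 for k even, and Q_k^{−−} := Σ_i (−1)^i·( a_i∘a_{i+k−1} + c₂₀·( a†_{i+k−2}∘a_i − a†_i∘a_{i+k−2} ) + a_i∘a_{i+k−3} − c₂₀·g_i + 2c₁₀·a_i ) for k odd. Then ⁅Q_k^{++}, H⁆ = 0 and ⁅Q_k^{−−}, H⁆ = 0; i.e., the quadratic model without number term possesses staggered k-local charges for every 3 ≤ k ≤ N/2 when N is even. -/
open MvPolynomial

noncomputable section

/-- The staggered sign `(−1)^i` (the parity character of `ZMod N`,
well defined as a character when `N` is even). -/
def stag (N : ℕ) [NeZero N] (i : ZMod N) : ℂ := (-1 : ℂ) ^ i.val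

section Staggered

variable {N : ℕ} {A : Type*} [Ring A] [Algebra ℂ A]

/-- A derivation `D` acting on the two canonically conjugate families `u`, `v` as the bracket
with (`σ` times) the quadratic hopping Hamiltonian with on-site term
`α u² + η u + γ v + β v²`. -/
structure IsQuadraticHopping (D : A →ₗ[ℂ] A) (u v : ZMod N → A) (σ τ α β γ η : ℂ) : Prop where
  leibniz : ∀ x y, D (x * y) = D x * y + x * D y
  map_fst : ∀ i, D (u i) = σ • (u (i - 1) + u (i + 1) + (2 * β) • v i + γ • 1)
  map_snd : ∀ i, D (v i) = -σ • (v (i - 1) + v (i + 1) + (2 * α) • u i + η • 1)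
  comm_fst : ∀ i j, u i * u j = u j * u i
  comm_snd : ∀ i j, v i * v j = v j * v i
  comm : ∀ i j, u i * v j = v j * u i + (if i = j then τ else 0) • 1

namespace IsQuadraticHopping

variable {D : A →ₗ[ℂ] A} {u v : ZMod N → A} {σ τ α β γ η : ℂ}

theorem symm (h : IsQuadraticHopping D u v σ τ α β γ η) :
    IsQuadraticHopping D v u (-σ) (-τ) β α η γ where
  leibniz := h.leibniz
  map_fst := h.map_snd
  map_snd i := by rw [neg_neg]; exact h.map_fst i
  comm_fst := h.comm_snd
  comm_snd := h.comm_fst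
  comm i j := by rw [h.comm j i]; by_cases hij : i = j <;> simp [hij, eq_comm]

end IsQuadraticHopping

variable [NeZero N]

theorem stag_add_one (hN : Even N) (i : ZMod N) : stag N (i + 1) = -stag N i := by
  have h1 : N ≠ 1 := by rintro rfl; exact absurd hN (by decide)
  have : Fact (1 < N) := ⟨by have := NeZero.ne N; lia⟩
  unfold stag
  have hmod (m : ℕ) : (-1 : ℂ) ^ (m % N) = (-1) ^ m := by
    conv_rhs => rw [← Nat.div_add_mod m N, pow_add, pow_mul, hN.neg_one_pow, one_pow, one_mul]
  rw [ZMod.val_add, ZMod.val_one, hmod, pow_succ, mul_neg_one]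

theorem sum_stag_add_one (hN : Even N) (f : ZMod N → A) :
    ∑ i, stag N i • f (i + 1) = -∑ i, stag N i • f i := by
  rw [← Equiv.sum_comp (Equiv.addRight (1 : ZMod N)) fun i => stag N i • f i,
    ← Finset.sum_neg_distrib]
  simp [stag_add_one hN]

theorem sum_stag_add_natCast (hN : Even N) (f : ZMod N → A) (n : ℕ) :
    ∑ i, stag N i • f (i + n) = (-1 : ℂ) ^ n • ∑ i, stag N i • f i := by
  induction n with
  | zero => simp
  | succ n ih =>
    have := sum_stag_add_one hN fun i => f (i + n)
    rw [ih] at this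
    simp only [Nat.cast_add, Nat.cast_one, pow_succ, mul_neg, mul_one, neg_smul, ← this]
    simp only [add_assoc, add_comm (1 : ZMod N)]

theorem sum_stag_const (hN : Even N) (c : A) : ∑ i : ZMod N, stag N i • c = 0 := by
  have := sum_stag_add_one hN fun _ : ZMod N => c
  have h2 : (2 : ℂ) • ∑ i : ZMod N, stag N i • c = 0 := by
    rw [two_smul]; nth_rewrite 1 [this]; simp
  simpa using h2

/-- Summation by parts: moving both hops from the first index to the second one changes
the sign of a staggered sum. -/
theorem sum_stag_hop (hN : Even N) (F : ZMod N → ZMod N → A) (d : ZMod N) :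
    ∑ i, stag N i • (F (i - 1) (i + d) + F (i + 1) (i + d)) =
      -∑ i, stag N i • (F i (i + d - 1) + F i (i + d + 1)) := by
  have h1 := sum_stag_add_one hN fun i => F (i - 1) (i + d)
  have h2 := sum_stag_add_one hN fun i => F i (i + d - 1)
  have e1 (i : ZMod N) : i + 1 + d = i + d + 1 := by ring
  have e2 (i : ZMod N) : i + d + 1 - 1 = i + d := by ring
  simp only [add_sub_cancel_right, e1, e2] at h1 h2
  simp only [smul_add, Finset.sum_add_distrib, h1, h2]
  abel

namespace IsQuadraticHopping

variable {D : A →ₗ[ℂ] A} {u v : ZMod N → A} {σ τ α β γ η : ℂ}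

theorem sum_comm (h : IsQuadraticHopping D u v σ τ α β γ η) (hN : Even N) (d : ZMod N) :
    ∑ i, stag N i • (v i * u (i + d)) = ∑ i, stag N i • (u (i + d) * v i) := by
  simp only [h.comm, smul_add, Finset.sum_add_distrib, add_eq_left]
  simp [sum_stag_const hN]

theorem map_sum_fst (h : IsQuadraticHopping D u v σ τ α β γ η) (hN : Even N) :
    D (∑ i, stag N i • u i) =
      σ • ((2 * β) • ∑ i, stag N i • v i - (2 : ℂ) • ∑ i, stag N i • u i) := by
  have h1 := sum_stag_hop hN (fun i _ => u i) 0
  have h2 := sum_stag_const (N := N) hN (γ • (1 : A))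
  rw [← add_eq_zero_iff_eq_neg] at h1
  rw [← sub_eq_zero]
  have h3 := congrArg (σ • ·) (congrArg₂ (· + ·) h1 h2)
  refine Eq.trans ?_ (h3.trans (by simp))
  simp only [map_sum, map_smul, h.map_fst, Finset.smul_sum, smul_add, smul_sub,
    ← Finset.sum_add_distrib, ← Finset.sum_sub_distrib]
  refine Finset.sum_congr rfl fun i _ => ?_
  module

theorem map_sum_fst_mul_fst (h : IsQuadraticHopping D u v σ τ α β γ η) (hN : Even N)
    (d : ZMod N) :
    D (∑ i, stag N i • (u i * u (i + d))) =
      σ • ((2 * β) • (∑ i, stag N i • (u i * v (i + d)) + ∑ i, stag N i • (u (i + d) * v i)) +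
        γ • (∑ i, stag N i • u i + ∑ i, stag N i • u (i + d))) := by
  have h1 := sum_stag_hop hN (fun i j => u i * u j) d
  rw [← h.sum_comm hN, ← sub_eq_zero]
  rw [← add_eq_zero_iff_eq_neg] at h1
  refine Eq.trans ?_ ((congrArg (σ • ·) h1).trans (smul_zero _))
  simp only [map_sum, map_smul, h.leibniz, h.map_fst, Finset.smul_sum, smul_add,
    ← Finset.sum_add_distrib, ← Finset.sum_sub_distrib]
  refine Finset.sum_congr rfl fun i _ => ?_
  simp only [add_mul, mul_add, smul_mul_assoc, mul_smul_comm, one_mul, mul_one, smul_add]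
  module

theorem map_sum_fst_mul_snd_sub (h : IsQuadraticHopping D u v σ τ α β γ η) (hN : Even N)
    (d : ZMod N) :
    D (∑ i, stag N i • (u i * v (i + d) - u (i + d) * v i)) =
      σ • (-(2 : ℂ) • (∑ i, stag N i • (u i * v (i + d - 1)) +
            ∑ i, stag N i • (u i * v (i + d + 1)) +
            ∑ i, stag N i • (u (i + d - 1) * v i) + ∑ i, stag N i • (u (i + d + 1) * v i)) +
        γ • (∑ i, stag N i • v (i + d) - ∑ i, stag N i • v i) +
        η • (∑ i, stag N i • u (i + d) - ∑ i, stag N i • u i)) := by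
  have h1 := sum_stag_hop hN (fun i j => u i * v j) d
  have h2 := sum_stag_hop hN (fun i j => u j * v i) d
  rw [← add_eq_zero_iff_eq_neg] at h1 h2
  rw [← sub_eq_zero]
  have h3 := congrArg (σ • ·) (congrArg₂ (· + ·) h1 h2)
  refine Eq.trans ?_ (h3.trans (by simp))
  simp only [map_sum, map_smul, map_sub, h.leibniz, h.map_fst, h.map_snd, Finset.smul_sum,
    smul_add, smul_sub, ← Finset.sum_add_distrib, ← Finset.sum_sub_distrib]
  refine Finset.sum_congr rfl fun i _ => ?_
  simp only [add_mul, mul_add, smul_mul_assoc, mul_smul_comm, one_mul, mul_one, smul_add,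
    h.comm_fst (i + d) i, h.comm_snd (i + d) i]
  module

theorem map_sum_onsite (h : IsQuadraticHopping D u v σ τ α β γ η) (hN : Even N) :
    D (∑ i, stag N i • (α • u i ^ 2 + η • u i + γ • v i + β • v i ^ 2)) =
      (2 * σ) • (γ • ∑ i, stag N i • v i - η • ∑ i, stag N i • u i) := by
  have h1 := h.map_sum_fst_mul_fst hN 0
  have h2 := h.symm.map_sum_fst_mul_fst hN 0
  have h3 := h.map_sum_fst hN
  have h4 := h.symm.map_sum_fst hN
  have h5 := h.sum_comm hN 0
  simp only [add_zero] at h1 h2 h5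
  rw [h5] at h2
  have hsum : ∑ i, stag N i • (α • u i ^ 2 + η • u i + γ • v i + β • v i ^ 2) =
      α • ∑ i, stag N i • (u i * u i) + η • ∑ i, stag N i • u i +
        γ • ∑ i, stag N i • v i + β • ∑ i, stag N i • (v i * v i) := by
    simp only [Finset.smul_sum, ← Finset.sum_add_distrib]
    refine Finset.sum_congr rfl fun i _ => ?_
    simp only [pow_two]
    module
  rw [hsum]
  simp only [map_add, map_smul, h1, h2, h3, h4]
  module

/-- The image of the staggered charge without on-site part; it vanishes for odd `e`. -/
theorem map_charge (h : IsQuadraticHopping D u v σ τ α β γ η) (hN : Even N) (e : ℕ) :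
    D (∑ i : ZMod N, stag N i • (u i * u (i + (e + 2 : ℕ)) +
      β • (u i * v (i + (e + 1 : ℕ)) - u (i + (e + 1 : ℕ)) * v i) + u i * u (i + e))) =
      (σ * (1 + (-1) ^ e)) • ((2 * γ) • ∑ i, stag N i • u i -
        β • (γ • ∑ i, stag N i • v i + η • ∑ i, stag N i • u i)) := by
  have h1 := h.map_sum_fst_mul_fst hN (e + 2 : ℕ)
  have h2 := h.map_sum_fst_mul_snd_sub hN (e + 1 : ℕ)
  have h3 := h.map_sum_fst_mul_fst hN (e : ℕ)
  have e1 (i : ZMod N) : i + (e + 1 : ℕ) - 1 = i + e := by push_cast; ring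
  have e2 (i : ZMod N) : i + (e + 1 : ℕ) + 1 = i + (e + 2 : ℕ) := by push_cast; ring
  simp only [e1, e2, sum_stag_add_natCast hN u, sum_stag_add_natCast hN v] at h1 h2 h3
  have hsum : ∑ i : ZMod N, stag N i • (u i * u (i + (e + 2 : ℕ)) +
        β • (u i * v (i + (e + 1 : ℕ)) - u (i + (e + 1 : ℕ)) * v i) + u i * u (i + e)) =
      ∑ i : ZMod N, stag N i • (u i * u (i + (e + 2 : ℕ))) +
        β • ∑ i : ZMod N, stag N i • (u i * v (i + (e + 1 : ℕ)) - u (i + (e + 1 : ℕ)) * v i) +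
        ∑ i : ZMod N, stag N i • (u i * u (i + e)) := by
    simp only [Finset.smul_sum, ← Finset.sum_add_distrib]
    refine Finset.sum_congr rfl fun i _ => ?_
    module
  rw [hsum]
  simp only [map_add, map_smul, h1, h2, h3]
  module

/-- The on-site correction of the staggered charge restores conservation for even `e`. -/
theorem map_charge_add_onsite (h : IsQuadraticHopping D u v σ τ α β γ η) (hN : Even N)
    {e : ℕ} (he : Even e) :
    D (∑ i : ZMod N, stag N i • (u i * u (i + (e + 2 : ℕ)) +
      β • (u i * v (i + (e + 1 : ℕ)) - u (i + (e + 1 : ℕ)) * v i) + u i * u (i + e) -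
      β • (α • u i ^ 2 + η • u i + γ • v i + β • v i ^ 2) + (2 * γ) • u i)) = 0 := by
  have h1 := h.map_charge hN e
  have h2 := h.map_sum_onsite hN
  have h3 := h.map_sum_fst hN
  rw [he.neg_one_pow] at h1
  have hsum (f g k : ZMod N → A) (b c : ℂ) : ∑ i, stag N i • (f i - b • g i + c • k i) =
      ∑ i, stag N i • f i - b • ∑ i, stag N i • g i + c • ∑ i, stag N i • k i := by
    simp only [Finset.smul_sum, ← Finset.sum_add_distrib, ← Finset.sum_sub_distrib]
    refine Finset.sum_congr rfl fun i _ => ?_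
    module
  rw [hsum]
  simp only [map_add, map_sub, map_smul, h1, h2, h3]
  module

end IsQuadraticHopping

end Staggered

/-- The commutator `⁅x, y⁆ = x * y - y * x` as a bilinear map. -/
def commutatorHom (A : Type*) [Ring A] [Algebra ℂ A] : A →ₗ[ℂ] A →ₗ[ℂ] A :=
  LinearMap.mul ℂ A - (LinearMap.mul ℂ A).flip

theorem commutatorHom_apply {A : Type*} [Ring A] [Algebra ℂ A] (x y : A) :
    commutatorHom A x y = x * y - y * x := rfl

theorem commutatorHom_mul_right {A : Type*} [Ring A] [Algebra ℂ A] (x y z : A) :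
    commutatorHom A x (y * z) = commutatorHom A x y * z + y * commutatorHom A x z := by
  simp only [commutatorHom_apply]
  noncomm_ring

theorem commutatorHom_mul_left {A : Type*} [Ring A] [Algebra ℂ A] (x y z : A) :
    commutatorHom A (x * y) z = commutatorHom A x z * y + x * commutatorHom A y z := by
  simp only [commutatorHom_apply]
  noncomm_ring

theorem isQuadraticHopping_commutatorHom {N : ℕ} [NeZero N] {A : Type*} [Ring A] [Algebra ℂ A]
    {u v : ZMod N → A} (huu : ∀ i j, u i * u j = u j * u i) (hvv : ∀ i j, v i * v j = v j * v i)
    (huv : ∀ i j, u i * v j = v j * u i + (if i = j then (-1 : ℂ) else 0) • 1) (α β γ η : ℂ) :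
    IsQuadraticHopping ((commutatorHom A).flip (∑ i : ZMod N, (u i * v (i + 1) + u (i + 1) * v i +
      (α • u i ^ 2 + η • u i + γ • v i + β • v i ^ 2)))) u v (-1) (-1) α β γ η where
  leibniz := fun x y => commutatorHom_mul_left x y _
  map_fst i := by
    have luu (i j : ZMod N) : commutatorHom A (u i) (u j) = 0 := by rw [commutatorHom_apply, huu, sub_self]
    have luv (i j : ZMod N) : commutatorHom A (u i) (v j) = (if i = j then (-1 : ℂ) else 0) • 1 := by
      rw [commutatorHom_apply, huv, add_sub_cancel_left]
    have e (j : ZMod N) : i = j + 1 ↔ i - 1 = j := sub_eq_iff_eq_add.symm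
    rw [LinearMap.flip_apply]
    simp only [map_sum, map_add, map_smul, pow_two, commutatorHom_mul_right,
      luu, luv, e, ite_smul, smul_ite, zero_smul, smul_zero, mul_ite, ite_mul,
      mul_zero, zero_mul, Finset.sum_add_distrib, Finset.sum_ite_eq, Finset.mem_univ, if_true,
      mul_smul_comm, smul_mul_assoc, mul_one, one_mul, smul_add, Finset.sum_const_zero]
    module
  map_snd i := by
    have lvv (i j : ZMod N) : commutatorHom A (v i) (v j) = 0 := by rw [commutatorHom_apply, hvv, sub_self]
    have lvu (i j : ZMod N) : commutatorHom A (v i) (u j) = (if i = j then (1 : ℂ) else 0) • 1 := by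
      rw [commutatorHom_apply, huv]
      by_cases h : i = j <;> simp [h, eq_comm]
    have e (j : ZMod N) : i = j + 1 ↔ i - 1 = j := sub_eq_iff_eq_add.symm
    rw [LinearMap.flip_apply]
    simp only [map_sum, map_add, map_smul, pow_two, commutatorHom_mul_right,
      lvv, lvu, e, ite_smul, smul_ite, zero_smul, smul_zero, mul_ite, ite_mul,
      mul_zero, zero_mul, Finset.sum_add_distrib, Finset.sum_ite_eq, Finset.mem_univ, if_true,
      mul_smul_comm, smul_mul_assoc, mul_one, one_mul, smul_add, Finset.sum_const_zero]
    module
  comm_fst := huu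
  comm_snd := hvv
  comm := huv

theorem ad_mul_an (N : ℕ) (i j : ZMod N) :
    ad N i * an N j = an N j * ad N i + (if i = j then (-1 : ℂ) else 0) • 1 := by
  refine LinearMap.ext fun p => ?_
  by_cases h : i = j <;> simp [an, ad, h, pderiv_X, mul_comm]

theorem ad_mul_ad (N : ℕ) (i j : ZMod N) : ad N i * ad N j = ad N j * ad N i := by
  refine LinearMap.ext fun p => ?_
  simp [ad, mul_left_comm]

theorem an_mul_an (N : ℕ) (i j : ZMod N) : an N i * an N j = an N j * an N i := by
  have h : ⁅pderiv (R := ℂ) i, pderiv (R := ℂ) j⁆ = 0 := by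
    refine MvPolynomial.derivation_ext fun l => ?_
    by_cases hi : i = l <;> by_cases hj : j = l <;>
      simp [Derivation.commutator_apply, pderiv_X, hi, hj, eq_comm]
  refine LinearMap.ext fun p => sub_eq_zero.mp ?_
  simpa [an, Derivation.commutator_apply] using DFunLike.congr_fun h p

/-- The quadratic model without number term possesses the two displayed staggered
`k`-local charges `Q_k^{++}` and `Q_k^{−−}` for every `3 ≤ k ≤ N/2` when `N` is even. -/
theorem staggered_quadratic_charges (N k : ℕ) [NeZero N]
    (hNeven : Even N) (hN : 6 ≤ N) (hk : 3 ≤ k) (hkN : 2 * k ≤ N)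
    (c20 c10 c01 c02 : ℂ)
    (g : ZMod N → Module.End ℂ (MvPolynomial (ZMod N) ℂ))
    (hg : ∀ i, g i = c20 • (ad N i) ^ 2 + c10 • ad N i + c01 • an N i + c02 • (an N i) ^ 2)
    (H Qpp Qmm : Module.End ℂ (MvPolynomial (ZMod N) ℂ))
    (hH : H = ∑ i : ZMod N,
        (ad N i * an N (i + 1) + ad N (i + 1) * an N i + g i))
    (hQpp : Qpp = if Even k then
          ∑ i : ZMod N, stag N i •
            (ad N i * ad N (i + ((k - 1 : ℕ) : ZMod N))
              + c02 • (ad N i * an N (i + ((k - 2 : ℕ) : ZMod N))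
                  - ad N (i + ((k - 2 : ℕ) : ZMod N)) * an N i)
              + ad N i * ad N (i + ((k - 3 : ℕ) : ZMod N)))
        else
          ∑ i : ZMod N, stag N i •
            (ad N i * ad N (i + ((k - 1 : ℕ) : ZMod N))
              + c02 • (ad N i * an N (i + ((k - 2 : ℕ) : ZMod N))
                  - ad N (i + ((k - 2 : ℕ) : ZMod N)) * an N i)
              + ad N i * ad N (i + ((k - 3 : ℕ) : ZMod N))
              - c02 • g i + (2 * c01) • ad N i))
    (hQmm : Qmm = if Even k then
          ∑ i : ZMod N, stag N i •
            (an N i * an N (i + ((k - 1 : ℕ) : ZMod N))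
              + c20 • (ad N (i + ((k - 2 : ℕ) : ZMod N)) * an N i
                  - ad N i * an N (i + ((k - 2 : ℕ) : ZMod N)))
              + an N i * an N (i + ((k - 3 : ℕ) : ZMod N)))
        else
          ∑ i : ZMod N, stag N i •
            (an N i * an N (i + ((k - 1 : ℕ) : ZMod N))
              + c20 • (ad N (i + ((k - 2 : ℕ) : ZMod N)) * an N i
                  - ad N i * an N (i + ((k - 2 : ℕ) : ZMod N)))
              + an N i * an N (i + ((k - 3 : ℕ) : ZMod N))
              - c20 • g i + (2 * c10) • an N i)) :
    ⁅Qpp, H⁆ = 0 ∧ ⁅Qmm, H⁆ = 0 := by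
  have h : IsQuadraticHopping ((commutatorHom _).flip H) (ad N) (an N) (-1) (-1) c20 c02 c01 c10 := by
    simpa only [hH, hg] using
      isQuadraticHopping_commutatorHom (ad_mul_ad N) (an_mul_an N) (ad_mul_an N) c20 c02 c01 c10
  obtain ⟨e, rfl⟩ := Nat.exists_eq_add_of_le' hk
  have hne (i : ZMod N) : i ≠ i + (e + 1 : ℕ) := by
    rw [ne_comm, Ne, add_eq_left, ZMod.natCast_eq_zero_iff]
    exact Nat.not_dvd_of_pos_of_lt (by lia) (by lia)
  have e1 : e + 3 - 1 = e + 2 := rfl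
  have e2 : e + 3 - 2 = e + 1 := rfl
  have e3 : e + 3 - 3 = e := rfl
  have hcomm (i : ZMod N) :
      ad N (i + (e + 1 : ℕ)) * an N i - ad N i * an N (i + (e + 1 : ℕ)) =
        an N i * ad N (i + (e + 1 : ℕ)) - an N (i + (e + 1 : ℕ)) * ad N i := by
    rw [ad_mul_an, ad_mul_an, if_neg (hne i), if_neg (hne i).symm, zero_smul, add_zero, add_zero]
  simp only [e1, e2, e3, hg, hcomm] at hQpp hQmm
  change (commutatorHom _).flip H Qpp = 0 ∧ (commutatorHom _).flip H Qmm = 0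
  rw [hQpp, hQmm]
  have hsymm (i : ZMod N) :
      c20 • (ad N i) ^ 2 + c10 • ad N i + c01 • an N i + c02 • (an N i) ^ 2 =
        c02 • (an N i) ^ 2 + c01 • an N i + c10 • ad N i + c20 • (ad N i) ^ 2 := by
    abel
  split_ifs with hev
  · have ho : Odd e := by grind
    exact ⟨by rw [h.map_charge hNeven, ho.neg_one_pow]; simp,
      by rw [h.symm.map_charge hNeven, ho.neg_one_pow]; simp⟩
  · have he : Even e := by grind
    exact ⟨h.map_charge_add_onsite hNeven he, by
      simp only [hsymm]
      exact h.symm.map_charge_add_onsite hNeven he⟩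

end
end
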